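/- arXiv:0708.2342 — 8 statements merged into one kernel-verified Lean document; each statement's English description precedes it below -/
import Mathlib

section
/- Let 0 < μ < m₀*, let p₀ ∈ (0,1), let T > 0, and let x : [0,T] → ℝ be twice continuously differentiable with x''(t) = g x(t) − μ F(x(t)) for all t ∈ [0,T], x(0) = p₀, x'(0) = 0, x'(t) > 0 for all t ∈ (0,T], and x(T) = ξ with ξ ≤ 1. Then T = ∫_{p₀}^{ξ} ds / √(g(s² − p₀²) − 2μ(𝓕(s) − 𝓕(p₀))) (the integrand being well defined and positive on (p₀, ξ] since s ↦ g(s² − p₀²) − 2μ(𝓕(s) − 𝓕(p₀)) is strictly increasing on [0,1] and vanishes at s = p₀). -/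
open Set intervalIntegral

/-- `m₀* = g / (max_{s ∈ [a,1]} F(s)/s)`. -/
noncomputable def m0star (g : ℝ) (F : ℝ → ℝ) (a : ℝ) : ℝ :=
  g / sSup ((fun s => F s / s) '' Set.Icc a 1)

/-- `𝓕(x) = ∫₀ˣ F(s) ds`. -/
noncomputable def Fprim (F : ℝ → ℝ) (x : ℝ) : ℝ := ∫ s in (0:ℝ)..x, F s

/-- Time-mapping formula: the time needed for a solution of `x'' = g x - μ F(x)`
starting at `(p₀,0)` to reach abscissa `ξ` while moving with positive velocity. -/
theorem time_mapping_formula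
    (g : ℝ) (hg : 0 < g)
    (F : ℝ → ℝ) (hFC1 : ContDiff ℝ 1 F)
    (a : ℝ) (ha0 : 0 < a) (ha1 : a < 1)
    (hF0 : F 0 = 0) (hFa : F a = 0) (hF1 : F 1 = 0)
    (hFneg₁ : ∀ s, 0 < s → s < a → F s < 0)
    (hFneg₂ : ∀ s, 1 < s → F s < 0)
    (hFpos₁ : ∀ s, s < 0 → 0 < F s)
    (hFpos₂ : ∀ s, a < s → s < 1 → 0 < F s)
    (μ : ℝ) (hμ0 : 0 < μ) (hμ : μ < m0star g F a)
    (p₀ : ℝ) (hp₀ : p₀ ∈ Set.Ioo (0:ℝ) 1)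
    (T : ℝ) (hT : 0 < T)
    (x x' x'' : ℝ → ℝ)
    (hx' : ∀ t ∈ Set.Icc 0 T, HasDerivWithinAt x (x' t) (Set.Icc 0 T) t)
    (hx'' : ∀ t ∈ Set.Icc 0 T, HasDerivWithinAt x' (x'' t) (Set.Icc 0 T) t)
    (hx''cont : ContinuousOn x'' (Set.Icc 0 T))
    (heq : ∀ t ∈ Set.Icc 0 T, x'' t = g * x t - μ * F (x t))
    (hx0 : x 0 = p₀) (hx'0 : x' 0 = 0)
    (hx'pos : ∀ t ∈ Set.Ioc 0 T, 0 < x' t)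
    (ξ : ℝ) (hxT : x T = ξ) (hξ : ξ ≤ 1) :
    StrictMonoOn (fun s => g * (s ^ 2 - p₀ ^ 2) - 2 * μ * (Fprim F s - Fprim F p₀))
      (Set.Icc 0 1) ∧
    (∀ s ∈ Set.Ioc p₀ ξ,
      0 < g * (s ^ 2 - p₀ ^ 2) - 2 * μ * (Fprim F s - Fprim F p₀)) ∧
    T = ∫ s in p₀..ξ,
      (Real.sqrt (g * (s ^ 2 - p₀ ^ 2) - 2 * μ * (Fprim F s - Fprim F p₀)))⁻¹ := by
  have hFc : Continuous F := hFC1.continuous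
  set G : ℝ → ℝ := fun s => g * (s ^ 2 - p₀ ^ 2) - 2 * μ * (Fprim F s - Fprim F p₀) with hG
  have hGd : ∀ s, HasDerivAt G (2 * (g * s - μ * F s)) s := by
    intro s
    have h1 : HasDerivAt (Fprim F) (F s) s :=
      integral_hasDerivAt_right (hFc.intervalIntegrable _ _)
        (hFc.stronglyMeasurableAtFilter _ _) hFc.continuousAt
    have h2 : HasDerivAt (fun s : ℝ => s ^ 2 - p₀ ^ 2) (2 * s) s := by
      simpa using (hasDerivAt_pow 2 s).sub_const (p₀ ^ 2)
    have h3 := (h2.const_mul g).sub ((h1.sub_const (Fprim F p₀)).const_mul (2 * μ))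
    refine h3.congr_deriv ?_
    ring
  have hGc : Continuous G := continuous_iff_continuousAt.2 fun s => (hGd s).continuousAt
  have hGp : G p₀ = 0 := by simp [hG]
  have hpos : ∀ s, 0 < s → s < 1 → 0 < g * s - μ * F s := by
    intro s hs0 hs1
    rcases lt_or_ge s a with h | h
    · have := hFneg₁ s hs0 h
      nlinarith [mul_pos hg hs0, mul_pos hμ0 (neg_pos.2 this)]
    · have hbdd : BddAbove ((fun s => F s / s) '' Set.Icc a 1) := by
        apply IsCompact.bddAbove
        apply isCompact_Icc.image_of_continuousOn
        apply hFc.continuousOn.div continuousOn_id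
        intro y hy
        exact (lt_of_lt_of_le ha0 hy.1).ne'
      unfold m0star at hμ
      set M := sSup ((fun s => F s / s) '' Set.Icc a 1)
      have hle : ∀ y ∈ Set.Icc a 1, F y / y ≤ M := fun y hy =>
        le_csSup hbdd (mem_image_of_mem _ hy)
      have hM : 0 < M := by
        refine lt_of_lt_of_le ?_ (hle ((a + 1) / 2) ⟨by linarith, by linarith⟩)
        exact div_pos (hFpos₂ _ (by linarith) (by linarith)) (by linarith)
      have h1 : μ * M < g := (lt_div_iff₀ hM).1 hμ
      have h2 : F s ≤ M * s := (div_le_iff₀ hs0).1 (hle s ⟨h, hs1.le⟩)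
      nlinarith [mul_le_mul_of_nonneg_left h2 hμ0.le, mul_pos (sub_pos.2 h1) hs0]
  have hmono : StrictMonoOn G (Set.Icc 0 1) := by
    apply strictMonoOn_of_deriv_pos (convex_Icc 0 1) hGc.continuousOn
    intro s hs
    rw [interior_Icc] at hs
    rw [(hGd s).deriv]
    linarith [hpos s hs.1 hs.2]
  have hGpos : ∀ s ∈ Set.Ioc p₀ ξ, 0 < G s := by
    intro s hs
    rw [← hGp]
    exact hmono ⟨hp₀.1.le, hp₀.2.le⟩ ⟨(hp₀.1.trans hs.1).le, hs.2.trans hξ⟩ hs.1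
  refine ⟨hmono, hGpos, ?_⟩
  have hxc : ContinuousOn x (Set.Icc 0 T) := fun t ht => (hx' t ht).continuousWithinAt
  have hx'c : ContinuousOn x' (Set.Icc 0 T) := fun t ht => (hx'' t ht).continuousWithinAt
  have hxm : StrictMonoOn x (Set.Icc 0 T) := by
    apply strictMonoOn_of_deriv_pos (convex_Icc 0 T) hxc
    intro t ht
    rw [interior_Icc] at ht
    rw [((hx' t ⟨ht.1.le, ht.2.le⟩).hasDerivAt (Icc_mem_nhds ht.1 ht.2)).deriv]
    exact hx'pos t ⟨ht.1, ht.2.le⟩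
  have hE : ∀ t ∈ Set.Icc 0 T, x' t ^ 2 = G (x t) := by
    have hd : ∀ t ∈ Set.Icc 0 T,
        HasDerivWithinAt (fun t => x' t ^ 2 - G (x t)) 0 (Set.Icc 0 T) t := by
      intro t ht
      have h1 := ((hx'' t ht).pow 2).sub ((hGd (x t)).comp_hasDerivWithinAt t (hx' t ht))
      refine h1.congr_deriv ?_
      rw [heq t ht]
      simp
      ring
    intro t ht
    have h := constant_of_has_deriv_right_zero (f := fun t => x' t ^ 2 - G (x t)) (a := 0) (b := T)
      (fun t ht => (hd t ht).continuousWithinAt)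
      (fun t ht => (hd t ⟨ht.1, ht.2.le⟩).mono_of_mem_nhdsWithin (Icc_mem_nhdsGE_of_mem ht)) t ht
    simp only [hx0, hx'0, hGp] at h
    linarith
  have h0m : (0:ℝ) ∈ Set.Icc 0 T := ⟨le_rfl, hT.le⟩
  have hTm : T ∈ Set.Icc 0 T := ⟨hT.le, le_rfl⟩
  have himg : x '' Set.Ioc 0 T = Set.Ioc p₀ ξ := by
    apply Subset.antisymm
    · rintro _ ⟨t, ht, rfl⟩
      rw [← hx0, ← hxT]
      exact ⟨hxm h0m ⟨ht.1.le, ht.2⟩ ht.1, hxm.monotoneOn ⟨ht.1.le, ht.2⟩ hTm ht.2⟩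
    · rw [← hx0, ← hxT]
      exact intermediate_value_Ioc hT.le hxc
  have hpξ : p₀ ≤ ξ := by
    rw [← hx0, ← hxT]
    exact (hxm h0m hTm hT).le
  rw [intervalIntegral.integral_of_le hpξ, ← himg,
    MeasureTheory.integral_image_eq_integral_abs_deriv_smul measurableSet_Ioc
      (fun t ht => (hx' t ⟨ht.1.le, ht.2⟩).mono Ioc_subset_Icc_self)
      (hxm.injOn.mono Ioc_subset_Icc_self)]
  have hone : ∀ t ∈ Set.Ioc 0 T, |x' t| • (Real.sqrt (G (x t)))⁻¹ = (1:ℝ) := by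
    intro t ht
    have hp := hx'pos t ht
    rw [← hE t ⟨ht.1.le, ht.2⟩, Real.sqrt_sq hp.le, abs_of_pos hp, smul_eq_mul,
      mul_inv_cancel₀ hp.ne']
  rw [MeasureTheory.setIntegral_congr_fun measurableSet_Ioc hone]
  simp [hT.le]
end

section
/- Assume F is strictly concave on [a,1] and 𝓕(1) = ∫₀¹ F(s) ds > 0, and set m₁* := g / (2𝓕(1)). Then for every μ > max(m₀*, m₁*), defining ℋ_μ(x) := g x² − 2μ 𝓕(x), there exists a unique b_μ ∈ (0,1] with ℋ_μ(b_μ) = 0; moreover ℋ_μ(x) > 0 for all x ∈ (0, b_μ), ℋ_μ(x) < 0 for all x ∈ (b_μ, 1], and a_μ < b_μ < c_μ. -/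
open Set intervalIntegral

/-- For `μ > max(m₀*, m₁*)` the function `ℋ_μ(x) = g x² - 2μ 𝓕(x)` has a unique zero
`b_μ ∈ (0,1]`, positive before and negative after, with `a_μ < b_μ < c_μ`. -/
theorem homoclinic_level_line
    (g : ℝ) (hg : 0 < g)
    (F : ℝ → ℝ) (hFC1 : ContDiff ℝ 1 F)
    (a : ℝ) (ha0 : 0 < a) (ha1 : a < 1)
    (hF0 : F 0 = 0) (hFa : F a = 0) (hF1 : F 1 = 0)
    (hFneg₁ : ∀ s, 0 < s → s < a → F s < 0)
    (hFneg₂ : ∀ s, 1 < s → F s < 0)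
    (hFpos₁ : ∀ s, s < 0 → 0 < F s)
    (hFpos₂ : ∀ s, a < s → s < 1 → 0 < F s)
    (hconc : StrictConcaveOn ℝ (Set.Icc a 1) F)
    (hint : 0 < Fprim F 1)
    (μ : ℝ) (hμ : max (m0star g F a) (g / (2 * Fprim F 1)) < μ)
    (aμ cμ : ℝ) (haμ : a < aμ) (haμcμ : aμ < cμ) (hcμ : cμ < 1)
    (heqa : g * aμ = μ * F aμ) (heqc : g * cμ = μ * F cμ)
    (hzeros : ∀ s ∈ Set.Ioo a 1, g * s = μ * F s → s = aμ ∨ s = cμ) :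
    ∃ bμ ∈ Set.Ioc (0:ℝ) 1,
      g * bμ ^ 2 - 2 * μ * Fprim F bμ = 0 ∧
      (∀ x ∈ Set.Ioc (0:ℝ) 1, g * x ^ 2 - 2 * μ * Fprim F x = 0 → x = bμ) ∧
      (∀ x ∈ Set.Ioo (0:ℝ) bμ, 0 < g * x ^ 2 - 2 * μ * Fprim F x) ∧
      (∀ x ∈ Set.Ioc bμ 1, g * x ^ 2 - 2 * μ * Fprim F x < 0) ∧
      aμ < bμ ∧ bμ < cμ := by
  have h2 : g / (2 * Fprim F 1) < μ := lt_of_le_of_lt (le_max_right _ _) hμ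
  have hμ0 : 0 < μ := lt_trans (by positivity) h2
  have hH1 : g * 1 ^ 2 - 2 * μ * Fprim F 1 < 0 := by
    rw [div_lt_iff₀ (by positivity)] at h2
    linarith
  have hcont : Continuous F := hFC1.continuous
  -- three point form of strict concavity
  have key : ∀ x y z, a ≤ x → x < y → y < z → z ≤ 1 →
      (z - y) * (g * y - μ * F y) + (y - x) * (g * y - μ * F y)
        < (z - y) * (g * x - μ * F x) + (y - x) * (g * z - μ * F z) := by
    intro x y z hx hxy hyz hz
    have h := hconc.slope_anti_adjacent (x := x) (y := y) (z := z)
      ⟨hx, by linarith⟩ ⟨by linarith, hz⟩ hxy hyz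
    rw [div_lt_div_iff₀ (by linarith) (by linarith)] at h
    have h' := mul_lt_mul_of_pos_left h hμ0
    nlinarith
  have hlow : ∀ x, 0 < x → x < aμ → 0 < g * x - μ * F x := by
    intro x hx hxa
    rcases le_or_gt x a with h | h
    · have hF : F x ≤ 0 := by
        rcases h.lt_or_eq with h | h
        · exact (hFneg₁ x hx h).le
        · rw [h, hFa]
      nlinarith [mul_pos hg hx, mul_nonneg hμ0.le (neg_nonneg.2 hF)]
    · by_contra hn
      have hk := key x aμ cμ h.le hxa haμcμ hcμ.le
      rw [heqa, heqc] at hk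
      nlinarith [mul_nonneg (sub_pos.2 haμcμ).le (neg_nonneg.2 (not_lt.1 hn))]
  have hmid : ∀ x, aμ < x → x < cμ → g * x - μ * F x < 0 := by
    intro x hx hxc
    have hk := key aμ x cμ haμ.le hx hxc hcμ.le
    rw [heqa, heqc] at hk
    by_contra hn
    nlinarith [mul_nonneg (sub_pos.2 haμcμ).le (not_lt.1 hn)]
  have hhigh : ∀ x, cμ < x → x < 1 → 0 < g * x - μ * F x := by
    intro x hx hx1
    by_contra hn
    have hk := key aμ cμ x haμ.le haμcμ hx hx1.le
    rw [heqa, heqc] at hk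
    nlinarith [mul_nonneg (sub_pos.2 haμcμ).le (neg_nonneg.2 (not_lt.1 hn))]
  set H : ℝ → ℝ := fun x => g * x ^ 2 - 2 * μ * Fprim F x with hH
  have hder : ∀ x, HasDerivAt H (2 * (g * x - μ * F x)) x := by
    intro x
    have h1 : HasDerivAt (Fprim F) (F x) x :=
      intervalIntegral.integral_hasDerivAt_right (hcont.intervalIntegrable _ _)
        (hcont.stronglyMeasurableAtFilter _ _) hcont.continuousAt
    have h3 := ((hasDerivAt_pow 2 x).const_mul g).sub (h1.const_mul (2 * μ))
    refine h3.congr_deriv ?_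
    push_cast
    ring
  have hHc : Continuous H := continuous_iff_continuousAt.2 fun x => (hder x).continuousAt
  have hH0 : H 0 = 0 := by simp [hH, Fprim]
  have m1 : StrictMonoOn H (Set.Icc 0 aμ) := by
    refine strictMonoOn_of_deriv_pos (convex_Icc _ _) hHc.continuousOn fun x hx => ?_
    rw [interior_Icc] at hx
    rw [(hder x).deriv]
    linarith [hlow x hx.1 hx.2]
  have m2 : StrictAntiOn H (Set.Icc aμ cμ) := by
    refine strictAntiOn_of_deriv_neg (convex_Icc _ _) hHc.continuousOn fun x hx => ?_
    rw [interior_Icc] at hx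
    rw [(hder x).deriv]
    linarith [hmid x hx.1 hx.2]
  have m3 : StrictMonoOn H (Set.Icc cμ 1) := by
    refine strictMonoOn_of_deriv_pos (convex_Icc _ _) hHc.continuousOn fun x hx => ?_
    rw [interior_Icc] at hx
    rw [(hder x).deriv]
    linarith [hhigh x hx.1 hx.2]
  have haμ0 : 0 < aμ := by linarith
  have p1 : ∀ x, 0 < x → x ≤ aμ → 0 < H x := by
    intro x hx hxa
    rw [← hH0]
    exact m1 ⟨le_rfl, haμ0.le⟩ ⟨hx.le, hxa⟩ hx
  have p3 : ∀ x, cμ ≤ x → x ≤ 1 → H x < 0 := by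
    intro x hx hx1
    exact lt_of_le_of_lt (m3.monotoneOn ⟨hx, hx1⟩ ⟨hcμ.le, le_rfl⟩ hx1) hH1
  obtain ⟨b, hb, hb0⟩ := intermediate_value_Ioo' haμcμ.le hHc.continuousOn
    (show (0:ℝ) ∈ Set.Ioo (H cμ) (H aμ) from ⟨p3 cμ le_rfl hcμ.le, p1 aμ haμ0 le_rfl⟩)
  have q1 : ∀ x ∈ Set.Ioo (0:ℝ) b, 0 < H x := by
    intro x hx
    rcases le_or_gt x aμ with h | h
    · exact p1 x hx.1 h
    · rw [← hb0]
      exact m2 ⟨h.le, (hx.2.trans hb.2).le⟩ ⟨hb.1.le, hb.2.le⟩ hx.2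
  have q2 : ∀ x ∈ Set.Ioc b 1, H x < 0 := by
    intro x hx
    rcases le_or_gt cμ x with h | h
    · exact p3 x h hx.2
    · rw [← hb0]
      exact m2 ⟨hb.1.le, hb.2.le⟩ ⟨(hb.1.trans hx.1).le, h.le⟩ hx.1
  refine ⟨b, ⟨haμ0.trans hb.1, (hb.2.trans hcμ).le⟩, hb0, ?_, q1, q2, hb.1, hb.2⟩
  intro x hx hx0
  rcases lt_trichotomy x b with h | h | h
  · exact absurd hx0 (q1 x ⟨hx.1, h⟩).ne'
  · exact h
  · exact absurd hx0 (q2 x ⟨h, hx.2⟩).ne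
end

section
/- Assume F is strictly concave on [a,1] and 𝓕(1) = ∫₀¹ F(s) ds > 0, set m₁* := g / (2𝓕(1)), and let μ > max(m₀*, m₁*). Then for every c with μ 𝓕(a_μ) − (g/2) a_μ² < c < 0, the equation −(g/2) x² + μ 𝓕(x) = c has exactly two solutions x in the interval (0,1); denoting them x₀ < x₁, they satisfy 0 < x₀ < a_μ < x₁ < b_μ. -/
open Set intervalIntegral

/-- For energies `c` between `𝓔(P)` and `0`, the equation `-(g/2)x² + μ 𝓕(x) = c`
has exactly two solutions `0 < x₀ < a_μ < x₁ < b_μ` in `(0,1)`. -/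
theorem closed_level_lines_two_intersections
    (g : ℝ) (hg : 0 < g)
    (F : ℝ → ℝ) (hFC1 : ContDiff ℝ 1 F)
    (a : ℝ) (ha0 : 0 < a) (ha1 : a < 1)
    (hF0 : F 0 = 0) (hFa : F a = 0) (hF1 : F 1 = 0)
    (hFneg₁ : ∀ s, 0 < s → s < a → F s < 0)
    (hFneg₂ : ∀ s, 1 < s → F s < 0)
    (hFpos₁ : ∀ s, s < 0 → 0 < F s)
    (hFpos₂ : ∀ s, a < s → s < 1 → 0 < F s)
    (hconc : StrictConcaveOn ℝ (Set.Icc a 1) F)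
    (hint : 0 < Fprim F 1)
    (μ : ℝ) (hμ : max (m0star g F a) (g / (2 * Fprim F 1)) < μ)
    (aμ cμ : ℝ) (haμ : a < aμ) (haμcμ : aμ < cμ) (hcμ : cμ < 1)
    (heqa : g * aμ = μ * F aμ) (heqc : g * cμ = μ * F cμ)
    (hzeros : ∀ s ∈ Set.Ioo a 1, g * s = μ * F s → s = aμ ∨ s = cμ)
    (bμ : ℝ) (hbμ : bμ ∈ Set.Ioc (0:ℝ) 1)
    (hbμ0 : g * bμ ^ 2 - 2 * μ * Fprim F bμ = 0)
    (hbμuniq : ∀ x ∈ Set.Ioc (0:ℝ) 1, g * x ^ 2 - 2 * μ * Fprim F x = 0 → x = bμ)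
    (c : ℝ) (hc₁ : μ * Fprim F aμ - g / 2 * aμ ^ 2 < c) (hc₂ : c < 0) :
    ∃ x₀ x₁ : ℝ, 0 < x₀ ∧ x₀ < aμ ∧ aμ < x₁ ∧ x₁ < bμ ∧
      -(g / 2) * x₀ ^ 2 + μ * Fprim F x₀ = c ∧
      -(g / 2) * x₁ ^ 2 + μ * Fprim F x₁ = c ∧
      (∀ x ∈ Set.Ioo (0:ℝ) 1, -(g / 2) * x ^ 2 + μ * Fprim F x = c → x = x₀ ∨ x = x₁) := by
  have hFi : 0 < g / (2 * Fprim F 1) := by positivity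
  have hμ1 : g / (2 * Fprim F 1) < μ := lt_of_le_of_lt (le_max_right _ _) hμ
  have hμ0 : 0 < μ := hFi.trans hμ1
  have hFc : Continuous F := hFC1.continuous
  obtain ⟨E, hE⟩ : ∃ E : ℝ → ℝ, E = fun x => -(g / 2) * x ^ 2 + μ * Fprim F x := ⟨_, rfl⟩
  have hEx : ∀ x, -(g / 2) * x ^ 2 + μ * Fprim F x = E x := fun x => by rw [hE]
  have hd : ∀ x, HasDerivAt E (μ * F x - g * x) x := by
    intro x
    have h1 : HasDerivAt (Fprim F) (F x) x :=
      intervalIntegral.integral_hasDerivAt_right (hFc.intervalIntegrable _ _)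
        (hFc.stronglyMeasurableAtFilter _ _) hFc.continuousAt
    have h2 := ((hasDerivAt_pow 2 x).const_mul (-(g / 2))).add (h1.const_mul μ)
    rw [hE]
    refine h2.congr_deriv ?_
    norm_num
    ring
  have hEc : Continuous E := continuous_iff_continuousAt.2 fun x => (hd x).continuousAt
  have hdd : ∀ x, deriv E x = μ * F x - g * x := fun x => (hd x).deriv
  have hmulpos : ∀ x, x ≤ aμ → a ≤ x → x < aμ → μ * F x - g * x < 0 := by
    intro x _ h1 h2
    have h := hconc.slope_anti_adjacent (x := x) (y := aμ) (z := cμ)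
      ⟨h1, by linarith⟩ ⟨by linarith, hcμ.le⟩ h2 haμcμ
    rw [div_lt_div_iff₀ (by linarith) (by linarith)] at h
    have h' := mul_lt_mul_of_pos_left h hμ0
    have e1 : μ * ((F cμ - F aμ) * (aμ - x)) = (g * cμ - g * aμ) * (aμ - x) := by
      rw [heqa, heqc]; ring
    have e2 : μ * ((F aμ - F x) * (cμ - aμ)) = (g * aμ - μ * F x) * (cμ - aμ) := by
      rw [heqa]; ring
    rw [e1, e2] at h'
    by_contra hh
    push Not at hh
    nlinarith [mul_nonneg hh (sub_pos.2 haμcμ).le]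
  have hneg1 : ∀ x, 0 < x → x < aμ → μ * F x - g * x < 0 := by
    intro x h0 h1
    rcases lt_or_ge x a with h | h
    · nlinarith [mul_neg_of_pos_of_neg hμ0 (hFneg₁ x h0 h), mul_pos hg h0]
    · exact hmulpos x h1.le h h1
  have hpos : ∀ x, aμ < x → x < cμ → 0 < μ * F x - g * x := by
    intro x h1 h2
    have h := hconc.slope_anti_adjacent (x := aμ) (y := x) (z := cμ)
      ⟨haμ.le, by linarith⟩ ⟨by linarith, hcμ.le⟩ h1 h2
    rw [div_lt_div_iff₀ (by linarith) (by linarith)] at h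
    have h' := mul_lt_mul_of_pos_left h hμ0
    have e1 : μ * ((F cμ - F x) * (x - aμ)) = (g * cμ - μ * F x) * (x - aμ) := by
      rw [heqc]; ring
    have e2 : μ * ((F x - F aμ) * (cμ - x)) = (μ * F x - g * aμ) * (cμ - x) := by
      rw [heqa]; ring
    rw [e1, e2] at h'
    by_contra hh
    push Not at hh
    nlinarith [mul_nonneg (sub_nonneg.2 hh) (sub_pos.2 haμcμ).le]
  have hneg2 : ∀ x, cμ < x → x < 1 → μ * F x - g * x < 0 := by
    intro x h1 h2
    have h := hconc.slope_anti_adjacent (x := aμ) (y := cμ) (z := x)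
      ⟨haμ.le, by linarith⟩ ⟨by linarith, h2.le⟩ haμcμ h1
    rw [div_lt_div_iff₀ (by linarith) (by linarith)] at h
    have h' := mul_lt_mul_of_pos_left h hμ0
    have e1 : μ * ((F x - F cμ) * (cμ - aμ)) = (μ * F x - g * cμ) * (cμ - aμ) := by
      rw [heqc]; ring
    have e2 : μ * ((F cμ - F aμ) * (x - cμ)) = (g * cμ - g * aμ) * (x - cμ) := by
      rw [heqa, heqc]; ring
    rw [e1, e2] at h'
    by_contra hh
    push Not at hh
    nlinarith [mul_nonneg hh (sub_pos.2 haμcμ).le]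
  have hA1 : StrictAntiOn E (Icc 0 aμ) := by
    refine strictAntiOn_of_deriv_neg (convex_Icc _ _) hEc.continuousOn fun x hx => ?_
    rw [interior_Icc] at hx
    rw [hdd]; exact hneg1 x hx.1 hx.2
  have hM : StrictMonoOn E (Icc aμ cμ) := by
    refine strictMonoOn_of_deriv_pos (convex_Icc _ _) hEc.continuousOn fun x hx => ?_
    rw [interior_Icc] at hx
    rw [hdd]; exact hpos x hx.1 hx.2
  have hA2 : StrictAntiOn E (Icc cμ 1) := by
    refine strictAntiOn_of_deriv_neg (convex_Icc _ _) hEc.continuousOn fun x hx => ?_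
    rw [interior_Icc] at hx
    rw [hdd]; exact hneg2 x hx.1 hx.2
  have hE0 : E 0 = 0 := by rw [← hEx]; simp [Fprim]
  have hE1 : 0 < E 1 := by
    rw [← hEx]
    rw [div_lt_iff₀ (by positivity)] at hμ1
    linarith
  have hEb : E bμ = 0 := by rw [← hEx]; linarith
  have hbig : ∀ x, cμ ≤ x → x ≤ 1 → 0 < E x := fun x h1 h2 =>
    hE1.trans_le (hA2.antitoneOn ⟨h1, h2⟩ ⟨hcμ.le, le_rfl⟩ h2)
  have hb1 : bμ < cμ := by
    by_contra hh
    push Not at hh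
    linarith [hbig bμ hh hbμ.2]
  have haμ0 : 0 < aμ := ha0.trans haμ
  have hb2 : aμ < bμ := by
    by_contra hh
    push Not at hh
    linarith [hA1 ⟨le_rfl, haμ0.le⟩ ⟨hbμ.1.le, hh⟩ hbμ.1]
  have hEa : E aμ < c := by rw [← hEx]; linarith
  obtain ⟨x₀, hx₀, hx₀c⟩ := intermediate_value_Ioo' haμ0.le hEc.continuousOn
    (show c ∈ Ioo (E aμ) (E 0) from ⟨hEa, by rw [hE0]; exact hc₂⟩)
  obtain ⟨x₁, hx₁, hx₁c⟩ := intermediate_value_Ioo hb2.le hEc.continuousOn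
    (show c ∈ Ioo (E aμ) (E bμ) from ⟨hEa, by rw [hEb]; exact hc₂⟩)
  refine ⟨x₀, x₁, hx₀.1, hx₀.2, hx₁.1, hx₁.2, (hEx _).trans hx₀c, (hEx _).trans hx₁c, ?_⟩
  intro x hx hxc
  rw [hEx] at hxc
  rcases le_total x aμ with h | h
  · exact Or.inl (hA1.injOn ⟨hx.1.le, h⟩ ⟨hx₀.1.le, hx₀.2.le⟩ (hxc.trans hx₀c.symm))
  · rcases le_total x cμ with h' | h'
    · exact Or.inr (hM.injOn ⟨h, h'⟩ ⟨hx₁.1.le, (hx₁.2.trans hb1).le⟩ (hxc.trans hx₁c.symm))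
    · linarith [hbig x h' hx.2.le]
end

section
/- Set Λ := sup_{0<s≤1} F(s)/s and Θ := sup_{0<s≤1} (−F(s)/s); both are finite, Λ > 0, and m₀* = g/Λ. Then for every μ with 0 < μ < m₀*, every p₀ with 0 < p₀ < 1, and every ξ with p₀ < ξ ≤ 1, one has (1/√(g + μΘ)) · arcosh(ξ/p₀) ≤ σ_μ(p₀, ξ) ≤ (1/√(g − μΛ)) · arcosh(ξ/p₀), where arcosh(y) = log(y + √(y² − 1)). -/
open Set intervalIntegral

/-- `σ_μ(p₀,ξ)`, the time-map integral. -/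
noncomputable def sigmaMap (g μ : ℝ) (F : ℝ → ℝ) (p₀ ξ : ℝ) : ℝ :=
  ∫ s in p₀..ξ, (Real.sqrt (g * (s ^ 2 - p₀ ^ 2) - 2 * μ * (Fprim F s - Fprim F p₀)))⁻¹

/-- `arcosh y = log (y + √(y² - 1))`. -/
noncomputable def arcosh (y : ℝ) : ℝ := Real.log (y + Real.sqrt (y ^ 2 - 1))

lemma tme_base (p ξ : ℝ) (hp : 0 < p) (h : p < ξ) :
    IntervalIntegrable (fun s => (Real.sqrt (s ^ 2 - p ^ 2))⁻¹) MeasureTheory.volume p ξ ∧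
    ∫ s in p..ξ, (Real.sqrt (s ^ 2 - p ^ 2))⁻¹ = arcosh (ξ / p) := by
  have hc : ContinuousOn (fun s => Real.arcosh (s / p)) (Icc p ξ) := by
    refine Real.continuousOn_arcosh.comp (by fun_prop) ?_
    intro s hs
    exact (one_le_div hp).2 hs.1
  have hd : ∀ s ∈ Ioo p ξ,
      HasDerivAt (fun s => Real.arcosh (s / p)) ((Real.sqrt (s ^ 2 - p ^ 2))⁻¹) s := by
    intro s hs
    have h1 : s / p ∈ Ioi (1:ℝ) := (one_lt_div hp).2 hs.1
    have h2 := (Real.hasDerivAt_arcosh h1).comp s ((hasDerivAt_id s).div_const p)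
    have h3 : (Real.sqrt ((s / p) ^ 2 - 1))⁻¹ * (1 / p) = (Real.sqrt (s ^ 2 - p ^ 2))⁻¹ := by
      have : s ^ 2 - p ^ 2 = p ^ 2 * ((s / p) ^ 2 - 1) := by field_simp
      rw [this, Real.sqrt_mul (by positivity), Real.sqrt_sq hp.le, mul_inv]
      ring
    rw [← h3]
    exact h2
  have hi : IntervalIntegrable (fun s => (Real.sqrt (s ^ 2 - p ^ 2))⁻¹)
      MeasureTheory.volume p ξ := by
    rw [intervalIntegrable_iff_integrableOn_Ioc_of_le h.le]
    exact integrableOn_deriv_of_nonneg hc hd (fun s _ => by positivity)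
  refine ⟨hi, ?_⟩
  rw [integral_eq_sub_of_hasDerivAt_of_le h.le hc hd hi, div_self hp.ne']
  simp [arcosh, Real.arcosh]

lemma tme_compare (D : ℝ → ℝ) (hD : Continuous D) (p ξ A B : ℝ) (hp : 0 < p) (h : p < ξ)
    (hA : 0 < A)
    (h1 : ∀ s ∈ Ioc p ξ, A * (s ^ 2 - p ^ 2) ≤ D s)
    (h2 : ∀ s ∈ Ioc p ξ, D s ≤ B * (s ^ 2 - p ^ 2)) :
    (1 / Real.sqrt B) * arcosh (ξ / p) ≤ ∫ s in p..ξ, (Real.sqrt (D s))⁻¹ ∧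
    ∫ s in p..ξ, (Real.sqrt (D s))⁻¹ ≤ (1 / Real.sqrt A) * arcosh (ξ / p) := by
  obtain ⟨hi, he⟩ := tme_base p ξ hp h
  have hpos : ∀ s ∈ Ioc p ξ, 0 < s ^ 2 - p ^ 2 := by
    intro s hs
    nlinarith [hs.1]
  have hB : 0 ≤ B := by
    have a1 := h1 ξ ⟨h, le_rfl⟩
    have a2 := h2 ξ ⟨h, le_rfl⟩
    have a3 := hpos ξ ⟨h, le_rfl⟩
    nlinarith [mul_pos hA a3]
  have hup : ∀ s ∈ Ioc p ξ,
      (Real.sqrt (D s))⁻¹ ≤ (1 / Real.sqrt A) * (Real.sqrt (s ^ 2 - p ^ 2))⁻¹ := by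
    intro s hs
    have := hpos s hs
    rw [one_div, ← mul_inv, ← Real.sqrt_mul hA.le]
    exact inv_anti₀ (Real.sqrt_pos.2 (by positivity)) (Real.sqrt_le_sqrt (h1 s hs))
  have hlo : ∀ s ∈ Ioc p ξ,
      (1 / Real.sqrt B) * (Real.sqrt (s ^ 2 - p ^ 2))⁻¹ ≤ (Real.sqrt (D s))⁻¹ := by
    intro s hs
    have := hpos s hs
    rw [one_div, ← mul_inv, ← Real.sqrt_mul hB]
    have h3 : 0 < D s := lt_of_lt_of_le (by positivity) (h1 s hs)
    exact inv_anti₀ (Real.sqrt_pos.2 h3) (Real.sqrt_le_sqrt (h2 s hs))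
  have hDi : IntervalIntegrable (fun s => (Real.sqrt (D s))⁻¹) MeasureTheory.volume p ξ := by
    refine (hi.const_mul (1 / Real.sqrt A)).mono_fun' ?_ ?_
    · exact (hD.measurable.sqrt.inv).aestronglyMeasurable
    · rw [uIoc_of_le h.le]
      filter_upwards [MeasureTheory.ae_restrict_mem measurableSet_Ioc] with s hs
      rw [Real.norm_of_nonneg (by positivity)]
      exact hup s hs
  rw [← he, ← integral_const_mul, ← integral_const_mul]
  exact ⟨integral_mono_on_of_le_Ioo h.le (hi.const_mul _) hDi
      (fun s hs => hlo s (Ioo_subset_Ioc_self hs)),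
    integral_mono_on_of_le_Ioo h.le hDi (hi.const_mul _)
      (fun s hs => hup s (Ioo_subset_Ioc_self hs))⟩

lemma tme_int (F : ℝ → ℝ) (hF : Continuous F) (p s C : ℝ) (h : p ≤ s)
    (hb : ∀ t ∈ Icc p s, F t ≤ C * t) :
    ∫ t in p..s, F t ≤ C * ((s ^ 2 - p ^ 2) / 2) := by
  rw [← integral_id, ← integral_const_mul]
  exact integral_mono_on h (hF.intervalIntegrable _ _)
    ((continuous_const.mul continuous_id).intervalIntegrable _ _) hb

/-- Lemma 3.2: two-sided estimates on the time map `σ_μ(p₀,ξ)` in terms of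
`Λ = sup_{0<s≤1} F(s)/s` and `Θ = sup_{0<s≤1} (-F(s)/s)`. -/
theorem time_map_estimates
    (g : ℝ) (hg : 0 < g)
    (F : ℝ → ℝ) (hFC1 : ContDiff ℝ 1 F)
    (a : ℝ) (ha0 : 0 < a) (ha1 : a < 1)
    (hF0 : F 0 = 0) (hFa : F a = 0) (hF1 : F 1 = 0)
    (hFneg₁ : ∀ s, 0 < s → s < a → F s < 0)
    (hFneg₂ : ∀ s, 1 < s → F s < 0)
    (hFpos₁ : ∀ s, s < 0 → 0 < F s)
    (hFpos₂ : ∀ s, a < s → s < 1 → 0 < F s) :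
    BddAbove ((fun s => F s / s) '' Set.Ioc (0:ℝ) 1) ∧
    BddAbove ((fun s => -F s / s) '' Set.Ioc (0:ℝ) 1) ∧
    0 < sSup ((fun s => F s / s) '' Set.Ioc (0:ℝ) 1) ∧
    m0star g F a = g / sSup ((fun s => F s / s) '' Set.Ioc (0:ℝ) 1) ∧
    (∀ μ : ℝ, 0 < μ → μ < m0star g F a →
      ∀ p₀ : ℝ, 0 < p₀ → p₀ < 1 → ∀ ξ : ℝ, p₀ < ξ → ξ ≤ 1 →
        (1 / Real.sqrt (g + μ * sSup ((fun s => -F s / s) '' Set.Ioc (0:ℝ) 1))) *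
            arcosh (ξ / p₀) ≤ sigmaMap g μ F p₀ ξ ∧
        sigmaMap g μ F p₀ ξ ≤
          (1 / Real.sqrt (g - μ * sSup ((fun s => F s / s) '' Set.Ioc (0:ℝ) 1))) *
            arcosh (ξ / p₀)) := by
  have hFc : Continuous F := hFC1.continuous
  obtain ⟨K, hK⟩ : ∃ K, ∀ x ∈ Icc (0:ℝ) 1, ‖deriv F x‖ ≤ K :=
    isCompact_Icc.exists_bound_of_continuousOn (hFC1.continuous_deriv le_rfl).continuousOn
  have hbd : ∀ s ∈ Ioc (0:ℝ) 1, |F s| ≤ K * s := by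
    intro s hs
    have := Convex.norm_image_sub_le_of_norm_deriv_le (f := F) (s := Icc (0:ℝ) 1) (x := 0) (y := s)
      (fun x _ => (hFC1.differentiable one_ne_zero) x) hK (convex_Icc 0 1) (by simp)
      ⟨hs.1.le, hs.2⟩
    simpa [hF0, abs_of_pos hs.1] using this
  have hb1 : BddAbove ((fun s => F s / s) '' Set.Ioc (0:ℝ) 1) := by
    refine ⟨K, ?_⟩
    rintro _ ⟨s, hs, rfl⟩
    exact (div_le_iff₀ hs.1).2 ((le_abs_self _).trans (hbd s hs))
  have hb2 : BddAbove ((fun s => -F s / s) '' Set.Ioc (0:ℝ) 1) := by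
    refine ⟨K, ?_⟩
    rintro _ ⟨s, hs, rfl⟩
    exact (div_le_iff₀ hs.1).2 ((neg_le_abs _).trans (hbd s hs))
  have hsub : Icc a 1 ⊆ Ioc (0:ℝ) 1 := fun s hs => ⟨ha0.trans_le hs.1, hs.2⟩
  have hpos : 0 < sSup ((fun s => F s / s) '' Set.Ioc (0:ℝ) 1) := by
    have hm : F ((a + 1) / 2) / ((a + 1) / 2) ≤ sSup ((fun s => F s / s) '' Set.Ioc (0:ℝ) 1) :=
      le_csSup hb1 ⟨(a + 1) / 2, ⟨by linarith, by linarith⟩, rfl⟩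
    exact lt_of_lt_of_le (div_pos (hFpos₂ _ (by linarith) (by linarith)) (by linarith)) hm
  have heq : sSup ((fun s => F s / s) '' Set.Icc a 1) =
      sSup ((fun s => F s / s) '' Set.Ioc (0:ℝ) 1) := by
    have hb3 := hb1.mono (image_mono (f := fun s => F s / s) hsub)
    apply le_antisymm
    · exact csSup_le_csSup hb1 ⟨_, a, ⟨le_rfl, ha1.le⟩, rfl⟩ (image_mono hsub)
    · refine csSup_le ⟨_, a, ⟨ha0, ha1.le⟩, rfl⟩ ?_
      rintro _ ⟨s, hs, rfl⟩
      rcases lt_or_ge s a with h | h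
      · have h1 : F a / a ≤ sSup ((fun s => F s / s) '' Set.Icc a 1) :=
          le_csSup hb3 ⟨a, ⟨le_rfl, ha1.le⟩, rfl⟩
        rw [hFa, zero_div] at h1
        exact (div_neg_of_neg_of_pos (hFneg₁ s hs.1 h) hs.1).le.trans h1
      · exact le_csSup hb3 ⟨s, ⟨h, hs.2⟩, rfl⟩
  have hm : m0star g F a = g / sSup ((fun s => F s / s) '' Set.Ioc (0:ℝ) 1) := by
    rw [m0star, heq]
  refine ⟨hb1, hb2, hpos, hm, ?_⟩
  intro μ hμ hμm p hp hp1 ξ hpξ hξ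
  rw [hm] at hμm
  have hΛ : ∀ t ∈ Ioc (0:ℝ) 1, F t ≤ sSup ((fun s => F s / s) '' Set.Ioc (0:ℝ) 1) * t :=
    fun t ht => (div_le_iff₀ ht.1).1 (le_csSup hb1 ⟨t, ht, rfl⟩)
  have hΘ : ∀ t ∈ Ioc (0:ℝ) 1, -F t ≤ sSup ((fun s => -F s / s) '' Set.Ioc (0:ℝ) 1) * t :=
    fun t ht => (div_le_iff₀ ht.1).1 (le_csSup hb2 ⟨t, ht, rfl⟩)
  generalize sSup ((fun s => F s / s) '' Set.Ioc (0:ℝ) 1) = L at *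
  generalize sSup ((fun s => -F s / s) '' Set.Ioc (0:ℝ) 1) = T at *
  have hA : 0 < g - μ * L := by
    have := (lt_div_iff₀ hpos).1 hμm
    linarith
  have hdiff : ∀ s, Fprim F s - Fprim F p = ∫ t in p..s, F t := fun s =>
    integral_interval_sub_left (hFc.intervalIntegrable _ _) (hFc.intervalIntegrable _ _)
  have hPc : Continuous (Fprim F) :=
    continuous_primitive (fun _ _ => hFc.intervalIntegrable _ _) 0
  refine tme_compare
    (fun s => g * (s ^ 2 - p ^ 2) - 2 * μ * (Fprim F s - Fprim F p)) (by fun_prop)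
    p ξ _ _ hp hpξ hA ?_ ?_
  · intro s hs
    have h1 := tme_int F hFc p s L hs.1.le
      (fun t ht => hΛ t ⟨hp.trans_le ht.1, ht.2.trans (hs.2.trans hξ)⟩)
    rw [← hdiff] at h1
    have h2 := mul_le_mul_of_nonneg_left h1 hμ.le
    linarith
  · intro s hs
    have h1 := tme_int (fun t => -F t) hFc.neg p s T hs.1.le
      (fun t ht => hΘ t ⟨hp.trans_le ht.1, ht.2.trans (hs.2.trans hξ)⟩)
    rw [integral_neg, ← hdiff] at h1
    have h2 := mul_le_mul_of_nonneg_left h1 hμ.le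
    linarith
end

section
/- Assume F is strictly concave on [a,1] and 𝓕(1) = ∫₀¹ F(s) ds > 0, and set m₁* := g/(2𝓕(1)). Fix x₀ ∈ (0,a) and let x₀⁺ ∈ (a,1) be the unique point with 𝓕(x₀⁺) = 𝓕(x₀). For each μ > max(m₀*, m₁*), let x₁(μ) denote the unique point of (a,1) satisfying g x₁(μ)² − 2μ 𝓕(x₁(μ)) = g x₀² − 2μ 𝓕(x₀) (which lies in (a_μ, b_μ)), and set τ(μ) := (2/√μ) ∫_{x₀}^{x₁(μ)} ds / √(2(𝓕(x₀) − 𝓕(s)) − (g/μ)(x₀² − s²)). Then lim_{μ→+∞} √μ · τ(μ) = √2 · ∫_{x₀}^{x₀⁺} ds / √(𝓕(x₀) − 𝓕(s)). -/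
open Set Filter intervalIntegral

theorem Fprim_hasDerivAt {F : ℝ → ℝ} (hF : Continuous F) (x : ℝ) :
    HasDerivAt (Fprim F) (F x) x :=
  intervalIntegral.integral_hasDerivAt_right (hF.intervalIntegrable _ _)
    (hF.stronglyMeasurableAtFilter _ _) hF.continuousAt

theorem bound_integrable_aux (k : ℝ) (hk : 0 < k) :
    IntervalIntegrable (fun u : ℝ => (Real.sqrt (k * u))⁻¹ + (Real.sqrt (k * (1 - u)))⁻¹)
      MeasureTheory.volume 0 1 := by
  have h1 : IntervalIntegrable (fun u : ℝ => (Real.sqrt (k * u))⁻¹)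
      MeasureTheory.volume 0 1 := by
    have h := (intervalIntegral.intervalIntegrable_rpow' (a := 0) (b := 1)
      (r := -(1/2)) (by norm_num)).const_mul ((Real.sqrt k)⁻¹)
    refine h.congr ?_
    intro u hu
    rw [uIoc_of_le zero_le_one] at hu
    simp only
    rw [Real.sqrt_mul hk.le, mul_inv, Real.rpow_neg hu.1.le, Real.sqrt_eq_rpow u]
  refine h1.add ?_
  have h2 := (h1.comp_sub_left 1).symm
  simpa using h2

theorem inv_sqrt_bound_aux {k u D : ℝ} (hk : 0 < k) (hu0 : 0 < u) (hu1 : u < 1)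
    (h : k * u ≤ D ∨ k * (1 - u) ≤ D) :
    ‖(Real.sqrt D)⁻¹‖ ≤ (Real.sqrt (k * u))⁻¹ + (Real.sqrt (k * (1 - u)))⁻¹ := by
  have p1 : 0 < k * u := mul_pos hk hu0
  have p2 : 0 < k * (1 - u) := mul_pos hk (by linarith)
  have q1 : 0 < (Real.sqrt (k * u))⁻¹ := inv_pos.2 (Real.sqrt_pos.2 p1)
  have q2 : 0 < (Real.sqrt (k * (1 - u)))⁻¹ := inv_pos.2 (Real.sqrt_pos.2 p2)
  rw [Real.norm_of_nonneg (inv_nonneg.2 (Real.sqrt_nonneg _))]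
  rcases h with h | h
  · have := inv_anti₀ (Real.sqrt_pos.2 p1) (Real.sqrt_le_sqrt h)
    linarith
  · have := inv_anti₀ (Real.sqrt_pos.2 p2) (Real.sqrt_le_sqrt h)
    linarith

set_option maxHeartbeats 2000000 in
/-- Lemma 3.3: asymptotics of the period `τ(μ)` of the closed orbit through `(x₀,0)`
as `μ → +∞`: `√μ · τ(μ) → √2 ∫_{x₀}^{x₀⁺} ds/√(𝓕(x₀)-𝓕(s))`. -/
theorem period_asymptotics
    (g : ℝ) (hg : 0 < g)
    (F : ℝ → ℝ) (hFC1 : ContDiff ℝ 1 F)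
    (a : ℝ) (ha0 : 0 < a) (ha1 : a < 1)
    (hF0 : F 0 = 0) (hFa : F a = 0) (hF1 : F 1 = 0)
    (hFneg₁ : ∀ s, 0 < s → s < a → F s < 0)
    (hFneg₂ : ∀ s, 1 < s → F s < 0)
    (hFpos₁ : ∀ s, s < 0 → 0 < F s)
    (hFpos₂ : ∀ s, a < s → s < 1 → 0 < F s)
    (hconc : StrictConcaveOn ℝ (Set.Icc a 1) F)
    (hint : 0 < Fprim F 1)
    (x₀ : ℝ) (hx₀ : x₀ ∈ Set.Ioo 0 a)
    (x₀p : ℝ) (hx₀p : x₀p ∈ Set.Ioo a 1) (hx₀peq : Fprim F x₀p = Fprim F x₀)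
    (x₁ : ℝ → ℝ)
    (hx₁ : ∀ μ : ℝ, max (m0star g F a) (g / (2 * Fprim F 1)) < μ →
      x₁ μ ∈ Set.Ioo a 1 ∧
      g * (x₁ μ) ^ 2 - 2 * μ * Fprim F (x₁ μ) = g * x₀ ^ 2 - 2 * μ * Fprim F x₀ ∧
      (∀ y ∈ Set.Ioo a 1,
        g * y ^ 2 - 2 * μ * Fprim F y = g * x₀ ^ 2 - 2 * μ * Fprim F x₀ → y = x₁ μ)) :
    Tendsto
      (fun μ : ℝ => Real.sqrt μ *
        ((2 / Real.sqrt μ) *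
          ∫ s in x₀..(x₁ μ),
            (Real.sqrt (2 * (Fprim F x₀ - Fprim F s) - g / μ * (x₀ ^ 2 - s ^ 2)))⁻¹))
      atTop
      (nhds (Real.sqrt 2 * ∫ s in x₀..x₀p, (Real.sqrt (Fprim F x₀ - Fprim F s))⁻¹)) := by
  obtain ⟨hx0, hxa⟩ := hx₀
  obtain ⟨hap, hp1⟩ := hx₀p
  have hFc : Continuous F := hFC1.continuous
  have hd : ∀ x, HasDerivAt (Fprim F) (F x) x := Fprim_hasDerivAt hFc
  have hdiff : Differentiable ℝ (Fprim F) := fun x => (hd x).differentiableAt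
  have hcont : Continuous (Fprim F) := hdiff.continuous
  have hder : ∀ x, deriv (Fprim F) x = F x := fun x => (hd x).deriv
  have hmono : StrictMonoOn (Fprim F) (Icc a 1) := by
    refine strictMonoOn_of_deriv_pos (convex_Icc _ _) hcont.continuousOn ?_
    intro x hx
    rw [interior_Icc] at hx
    rw [hder]; exact hFpos₂ x hx.1 hx.2
  have hanti : StrictAntiOn (Fprim F) (Icc 0 a) := by
    refine strictAntiOn_of_deriv_neg (convex_Icc _ _) hcont.continuousOn ?_
    intro x hx
    rw [interior_Icc] at hx
    rw [hder]; exact hFneg₁ x hx.1 hx.2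
  have hlt : ∀ s, x₀ < s → s < x₀p → Fprim F s < Fprim F x₀ := by
    intro s h1 h2
    rcases le_or_gt s a with h | h
    · exact hanti ⟨hx0.le, hxa.le⟩ ⟨by linarith, h⟩ h1
    · rw [← hx₀peq]
      exact hmono ⟨h.le, by linarith⟩ ⟨hap.le, hp1.le⟩ h2
  -- eventually facts
  set M := max (m0star g F a) (g / (2 * Fprim F 1)) with hM
  have hev0 : ∀ᶠ μ : ℝ in atTop, M < μ ∧ 0 < μ :=
    (eventually_gt_atTop M).and (eventually_gt_atTop 0)
  have hgt : ∀ μ, M < μ → 0 < μ → x₀p < x₁ μ := by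
    intro μ h1 h2
    obtain ⟨⟨ha, hb⟩, he, -⟩ := hx₁ μ h1
    rw [← hmono.lt_iff_lt ⟨hap.le, hp1.le⟩ ⟨ha.le, hb.le⟩, hx₀peq]
    have : x₀ ^ 2 < (x₁ μ) ^ 2 := by nlinarith
    have h3 : 0 < μ * (Fprim F (x₁ μ) - Fprim F x₀) := by
      have := mul_lt_mul_of_pos_left this hg
      linarith
    have := pos_of_mul_pos_right h3 h2.le
    linarith
  have hevlt : ∀ y, x₀p < y → y < 1 → ∀ᶠ μ : ℝ in atTop, x₁ μ < y := by
    intro y hy hy1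
    have hpos : 0 < Fprim F y - Fprim F x₀ := by
      rw [← hx₀peq]
      exact sub_pos.2 (hmono ⟨hap.le, hp1.le⟩ ⟨by linarith, hy1.le⟩ hy)
    filter_upwards [hev0, eventually_gt_atTop (g / (Fprim F y - Fprim F x₀))] with μ hμ hμ2
    obtain ⟨⟨ha, hb⟩, he, -⟩ := hx₁ μ hμ.1
    rw [← hmono.lt_iff_lt ⟨ha.le, hb.le⟩ ⟨by linarith, hy1.le⟩]
    rw [div_lt_iff₀ hpos] at hμ2
    by_contra hcon
    push Not at hcon
    have h1 : μ * Fprim F y ≤ μ * Fprim F (x₁ μ) := mul_le_mul_of_nonneg_left hcon hμ.2.le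
    have h2 : (x₁ μ) ^ 2 < 1 := by nlinarith
    have h3 := mul_lt_mul_of_pos_left h2 hg
    have h4 : 0 ≤ g * x₀ ^ 2 := by positivity
    nlinarith
  have hx₁lim : Tendsto x₁ atTop (nhds x₀p) := by
    rw [tendsto_order]
    constructor
    · intro y hy
      filter_upwards [hev0] with μ hμ
      exact hy.trans (hgt μ hμ.1 hμ.2)
    · intro y hy
      filter_upwards [hevlt (min y ((x₀p + 1) / 2)) (lt_min hy (by linarith))
        (min_lt_of_right_lt (by linarith))] with μ hμ
      exact hμ.trans_le (min_le_left _ _)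
  -- lower bounds
  obtain ⟨d, hd1, hd2⟩ : ∃ d, a < d ∧ d < x₀p := exists_between hap
  obtain ⟨e, he1, he2⟩ : ∃ e, x₀p < e ∧ e < 1 := exists_between hp1
  obtain ⟨c₁, hc₁, hb₁⟩ : ∃ c, 0 < c ∧ ∀ s ∈ Icc x₀ d,
      c * (s - x₀) ≤ Fprim F x₀ - Fprim F s := by
    have hds : Continuous (dslope (Fprim F) x₀) := by
      rw [← continuousOn_univ, continuousOn_dslope univ_mem]
      exact ⟨hcont.continuousOn, hdiff x₀⟩
    obtain ⟨z, hz, hzm⟩ := isCompact_Icc.exists_isMaxOn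
      (nonempty_Icc.2 (show x₀ ≤ d by linarith)) hds.continuousOn
    refine ⟨-dslope (Fprim F) x₀ z, ?_, ?_⟩
    · rw [neg_pos]
      rcases eq_or_lt_of_le hz.1 with h | h
      · rw [← h, dslope_same, hder]
        exact hFneg₁ x₀ hx0 hxa
      · have h1 := sub_smul_dslope (Fprim F) x₀ z
        have h2 := hlt z h (by linarith [hz.2])
        rw [smul_eq_mul] at h1
        by_contra hcon
        push Not at hcon
        have := mul_nonneg (sub_nonneg.2 h.le) hcon
        linarith
    · intro s hs
      have h1 := sub_smul_dslope (Fprim F) x₀ s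
      rw [smul_eq_mul] at h1
      have h2 : dslope (Fprim F) x₀ s ≤ dslope (Fprim F) x₀ z := hzm hs
      have := mul_le_mul_of_nonneg_left h2 (sub_nonneg.2 hs.1)
      linarith
  obtain ⟨c₂, hc₂, hb₂⟩ : ∃ c, 0 < c ∧ ∀ s ∈ Icc d e, ∀ t ∈ Icc d e, s ≤ t →
      c * (t - s) ≤ Fprim F t - Fprim F s := by
    obtain ⟨z, hz, hzm⟩ := isCompact_Icc.exists_isMinOn
      (nonempty_Icc.2 (show d ≤ e by linarith)) hFc.continuousOn
    refine ⟨F z, hFpos₂ z (by linarith [hz.1]) (by linarith [hz.2]), ?_⟩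
    refine (convex_Icc d e).mul_sub_le_image_sub_of_le_deriv hcont.continuousOn
      hdiff.differentiableOn ?_
    intro x hx
    rw [hder]
    exact hzm (interior_subset hx)
  -- rescaled integrand
  let D : ℝ → ℝ → ℝ := fun μ s =>
    2 * (Fprim F x₀ - Fprim F s) - g / μ * (x₀ ^ 2 - s ^ 2)
  let k : ℝ := min c₁ c₂ * (a - x₀)
  have hk : 0 < k := mul_pos (lt_min hc₁ hc₂) (by linarith)
  have hkey : Tendsto (fun μ : ℝ => ∫ u in (0:ℝ)..1,
      (Real.sqrt (D μ (x₀ + (x₁ μ - x₀) * u)))⁻¹) atTop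
      (nhds (∫ u in (0:ℝ)..1,
        (Real.sqrt (2 * (Fprim F x₀ - Fprim F (x₀ + (x₀p - x₀) * u))))⁻¹)) := by
    have hne : ∀ᵐ u : ℝ, u ≠ 1 := by
      simp [MeasureTheory.ae_iff]
    refine intervalIntegral.tendsto_integral_filter_of_dominated_convergence
      (fun u : ℝ => (Real.sqrt (k * u))⁻¹ + (Real.sqrt (k * (1 - u)))⁻¹)
      ?_ ?_ (bound_integrable_aux k hk) ?_
    · refine Eventually.of_forall fun μ => ?_
      have : Continuous fun u : ℝ => D μ (x₀ + (x₁ μ - x₀) * u) := by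
        simp only [D]
        fun_prop
      exact (this.measurable.sqrt.inv).aestronglyMeasurable
    · filter_upwards [hev0, hevlt e he1 he2, eventually_gt_atTop (2 * g / c₂)] with μ hμ hμe hμg
      filter_upwards [hne] with u hu hu'
      rw [uIoc_of_le zero_le_one] at hu'
      have hu0 := hu'.1
      have hu1 : u < 1 := lt_of_le_of_ne hu'.2 hu
      refine inv_sqrt_bound_aux hk hu0 hu1 ?_
      obtain ⟨⟨ha, hb⟩, he, -⟩ := hx₁ μ hμ.1
      have hpx := hgt μ hμ.1 hμ.2
      have hgm : 0 < g / μ := div_pos hg hμ.2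
      have hgm2 : g / μ < c₂ / 2 := by
        rw [div_lt_iff₀ hc₂] at hμg
        rw [div_lt_iff₀ hμ.2]
        linarith
      have hD1 : D μ (x₁ μ) = 0 := by
        simp only [D]
        have := hμ.2.ne'
        field_simp
        linarith
      have hL : a - x₀ ≤ x₁ μ - x₀ := by linarith
      generalize hs : x₀ + (x₁ μ - x₀) * u = s
      have hsx : x₀ < s := by
        rw [← hs]
        have : 0 < (x₁ μ - x₀) * u := mul_pos (by linarith) hu0
        linarith
      have hsx1 : s < x₁ μ := by
        rw [← hs]
        have : 0 < (x₁ μ - x₀) * (1 - u) := mul_pos (by linarith) (by linarith)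
        linarith
      rcases le_or_gt s d with hsd | hsd
      · left
        have h1 := hb₁ s ⟨hsx.le, hsd⟩
        have h2 : 0 ≤ g / μ * (s ^ 2 - x₀ ^ 2) := mul_nonneg hgm.le (by nlinarith)
        have h3 : k * u ≤ c₁ * (s - x₀) := by
          have : s - x₀ = (x₁ μ - x₀) * u := by linarith
          rw [this, ← mul_assoc]
          refine mul_le_mul_of_nonneg_right ?_ hu0.le
          exact mul_le_mul (min_le_left _ _) hL (by linarith) hc₁.le
        have h4 : 0 ≤ c₁ * (s - x₀) := mul_nonneg hc₁.le (by linarith)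
        simp only [D]
        linarith
      · right
        have h1 := hb₂ s ⟨hsd.le, by linarith⟩ (x₁ μ) ⟨by linarith, hμe.le⟩ hsx1.le
        have h3 : k * (1 - u) ≤ c₂ * (x₁ μ - s) := by
          have : x₁ μ - s = (x₁ μ - x₀) * (1 - u) := by linarith
          rw [this, ← mul_assoc]
          refine mul_le_mul_of_nonneg_right ?_ (by linarith)
          exact mul_le_mul (min_le_right _ _) hL (by linarith) hc₂.le
        have h5 : (x₁ μ) ^ 2 - s ^ 2 ≤ 2 * (x₁ μ - s) := by nlinarith
        have h6 : g / μ * ((x₁ μ) ^ 2 - s ^ 2) ≤ c₂ / 2 * (2 * (x₁ μ - s)) :=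
          mul_le_mul hgm2.le h5 (by nlinarith) (by linarith)
        have h7 : D μ s = 2 * (Fprim F (x₁ μ) - Fprim F s)
            - g / μ * ((x₁ μ) ^ 2 - s ^ 2) := by
          rw [← sub_zero (D μ s), ← hD1]
          simp only [D]
          ring
        rw [h7]
        linarith
    · filter_upwards [hne] with u hu hu'
      rw [uIoc_of_le zero_le_one] at hu'
      have hu0 := hu'.1
      have hu1 : u < 1 := lt_of_le_of_ne hu'.2 hu
      have hpos : 0 < 2 * (Fprim F x₀ - Fprim F (x₀ + (x₀p - x₀) * u)) := by
        have h1 : 0 < (x₀p - x₀) * u := mul_pos (by linarith) hu0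
        have h2 : 0 < (x₀p - x₀) * (1 - u) := mul_pos (by linarith) (by linarith)
        have := hlt (x₀ + (x₀p - x₀) * u) (by linarith) (by linarith)
        linarith
      have hs : Tendsto (fun μ => x₀ + (x₁ μ - x₀) * u) atTop
          (nhds (x₀ + (x₀p - x₀) * u)) :=
        ((hx₁lim.sub_const x₀).mul_const u).const_add x₀
      have hg0 : Tendsto (fun μ : ℝ => g / μ) atTop (nhds 0) :=
        tendsto_const_nhds.div_atTop tendsto_id
      have hDl : Tendsto (fun μ => D μ (x₀ + (x₁ μ - x₀) * u)) atTop
          (nhds (2 * (Fprim F x₀ - Fprim F (x₀ + (x₀p - x₀) * u)))) := by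
        have h1 := (((hcont.tendsto _).comp hs).const_sub (Fprim F x₀)).const_mul 2
        have h2 := hg0.mul ((hs.pow 2).const_sub (x₀ ^ 2))
        have h3 := h1.sub h2
        rw [zero_mul, sub_zero] at h3
        exact h3
      exact ((Real.continuous_sqrt.tendsto _).comp hDl).inv₀ (Real.sqrt_pos.2 hpos).ne'
  have hfin := ((hx₁lim.sub_const x₀).mul hkey).const_mul 2
  have hlimeq : 2 * ((x₀p - x₀) * ∫ u in (0:ℝ)..1,
        (Real.sqrt (2 * (Fprim F x₀ - Fprim F (x₀ + (x₀p - x₀) * u))))⁻¹)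
      = Real.sqrt 2 * ∫ s in x₀..x₀p, (Real.sqrt (Fprim F x₀ - Fprim F s))⁻¹ := by
    rw [intervalIntegral.mul_integral_comp_add_mul
      (f := fun s => (Real.sqrt (2 * (Fprim F x₀ - Fprim F s)))⁻¹)]
    have h1 : ∀ s, (Real.sqrt (2 * (Fprim F x₀ - Fprim F s)))⁻¹
        = (Real.sqrt 2)⁻¹ * (Real.sqrt (Fprim F x₀ - Fprim F s))⁻¹ := by
      intro s
      rw [Real.sqrt_mul (by norm_num), mul_inv]
    simp only [h1, intervalIntegral.integral_const_mul, mul_zero, add_zero, mul_one,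
      add_sub_cancel]
    rw [← mul_assoc]
    congr 1
    rw [← div_eq_mul_inv, Real.div_sqrt]
  rw [← hlimeq]
  refine hfin.congr' ?_
  filter_upwards [hev0] with μ hμ
  have h1 := intervalIntegral.mul_integral_comp_add_mul (a := 0) (b := 1)
    (f := fun s => (Real.sqrt (D μ s))⁻¹) (x₁ μ - x₀) x₀
  rw [h1]
  have h2 : Real.sqrt μ ≠ 0 := (Real.sqrt_pos.2 hμ.2).ne'
  rw [← mul_assoc (Real.sqrt μ), mul_div_cancel₀ _ h2]
  simp only [mul_zero, add_zero, mul_one, add_sub_cancel, D]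
end

section
/- Assume F is strictly concave on [a,1] and 𝓕(1) = ∫₀¹ F(s) ds > 0, set m₁* := g/(2𝓕(1)), and let b ∈ (a,1) be the unique point with 𝓕(b) = 0. Then b_μ > b for every μ > max(m₀*, m₁*); the map μ ↦ b_μ is strictly decreasing on (max(m₀*, m₁*), +∞) (i.e. b_{μ'} < b_μ whenever max(m₀*, m₁*) < μ < μ'); and b_μ → b as μ → +∞. -/
open Set Filter intervalIntegral

/-- Monotonicity and limit of `μ ↦ b_μ`: `b_μ > b`, `b_μ` is strictly decreasing in `μ`,
and `b_μ → b` as `μ → +∞`. -/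
theorem bmu_monotone_limit
    (g : ℝ) (hg : 0 < g)
    (F : ℝ → ℝ) (hFC1 : ContDiff ℝ 1 F)
    (a : ℝ) (ha0 : 0 < a) (ha1 : a < 1)
    (hF0 : F 0 = 0) (hFa : F a = 0) (hF1 : F 1 = 0)
    (hFneg₁ : ∀ s, 0 < s → s < a → F s < 0)
    (hFneg₂ : ∀ s, 1 < s → F s < 0)
    (hFpos₁ : ∀ s, s < 0 → 0 < F s)
    (hFpos₂ : ∀ s, a < s → s < 1 → 0 < F s)
    (hconc : StrictConcaveOn ℝ (Set.Icc a 1) F)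
    (hint : 0 < Fprim F 1)
    (b : ℝ) (hb : b ∈ Set.Ioo a 1) (hbeq : Fprim F b = 0)
    (bμ : ℝ → ℝ)
    (hbμ : ∀ μ : ℝ, max (m0star g F a) (g / (2 * Fprim F 1)) < μ →
      bμ μ ∈ Set.Ioc (0:ℝ) 1 ∧
      g * (bμ μ) ^ 2 - 2 * μ * Fprim F (bμ μ) = 0 ∧
      (∀ x ∈ Set.Ioc (0:ℝ) 1, g * x ^ 2 - 2 * μ * Fprim F x = 0 → x = bμ μ)) :
    (∀ μ : ℝ, max (m0star g F a) (g / (2 * Fprim F 1)) < μ → b < bμ μ) ∧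
    StrictAntiOn bμ (Set.Ioi (max (m0star g F a) (g / (2 * Fprim F 1)))) ∧
    Tendsto bμ atTop (nhds b) := by
  have hFc : Continuous F := hFC1.continuous
  have hder : ∀ x, HasDerivAt (Fprim F) (F x) x := fun x =>
    intervalIntegral.integral_hasDerivAt_right (hFc.intervalIntegrable _ _)
      hFc.aestronglyMeasurable.stronglyMeasurableAtFilter hFc.continuousAt
  have hΦc : Continuous (Fprim F) :=
    continuous_iff_continuousAt.2 fun x => (hder x).continuousAt
  have hΦ0 : Fprim F 0 = 0 := by simp [Fprim]
  have hanti : StrictAntiOn (Fprim F) (Set.Icc 0 a) := by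
    apply strictAntiOn_of_deriv_neg (convex_Icc 0 a) hΦc.continuousOn
    intro x hx
    rw [interior_Icc] at hx
    rw [(hder x).deriv]
    exact hFneg₁ x hx.1 hx.2
  have hmono : StrictMonoOn (Fprim F) (Set.Icc a 1) := by
    apply strictMonoOn_of_deriv_pos (convex_Icc a 1) hΦc.continuousOn
    intro x hx
    rw [interior_Icc] at hx
    rw [(hder x).deriv]
    exact hFpos₂ x hx.1 hx.2
  obtain ⟨hb1, hb2⟩ := hb
  have hb0 : 0 < b := ha0.trans hb1
  have hpos : ∀ x, b < x → x ≤ 1 → 0 < Fprim F x := by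
    intro x hx hx1
    rw [← hbeq]
    exact hmono ⟨hb1.le, hb2.le⟩ ⟨(hb1.trans hx).le, hx1⟩ hx
  have hneg : ∀ x, 0 < x → x ≤ b → Fprim F x ≤ 0 := by
    intro x hx hxb
    rcases le_total x a with h | h
    · rw [← hΦ0]
      exact hanti.antitoneOn ⟨le_rfl, ha0.le⟩ ⟨hx.le, h⟩ hx.le
    · rw [← hbeq]
      exact hmono.monotoneOn ⟨h, hxb.trans hb2.le⟩ ⟨hb1.le, hb2.le⟩ hxb
  set M := max (m0star g F a) (g / (2 * Fprim F 1)) with hM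
  have hM0 : 0 < M := lt_of_lt_of_le (by positivity) (le_max_right _ _)
  have key1 : ∀ μ : ℝ, M < μ → b < bμ μ := by
    intro μ hμ
    obtain ⟨⟨h0, h1⟩, h2, -⟩ := hbμ μ hμ
    by_contra! h
    have h3 := hneg _ h0 h
    have h4 : 0 < g * (bμ μ) ^ 2 := by positivity
    have h5 : 0 < μ := hM0.trans hμ
    nlinarith [mul_nonneg h5.le (neg_nonneg.2 h3)]
  have key2 : ∀ μ x : ℝ, M < μ → b < x → x ≤ 1 →
      g * x ^ 2 - 2 * μ * Fprim F x < 0 → bμ μ < x := by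
    intro μ x hμ hbx hx1 hH
    have hc : ContinuousOn (fun x => g * x ^ 2 - 2 * μ * Fprim F x) (Set.Icc b x) := by
      fun_prop
    have hiv := intermediate_value_Ioo' hbx.le hc
    have hHb : 0 < g * b ^ 2 - 2 * μ * Fprim F b := by
      rw [hbeq]
      have : 0 < g * b ^ 2 := by positivity
      linarith
    obtain ⟨y, hy, hy0⟩ := hiv ⟨hH, hHb⟩
    rw [← (hbμ μ hμ).2.2 y ⟨hb0.trans hy.1, (hy.2.trans_le hx1).le⟩ hy0]
    exact hy.2
  refine ⟨key1, ?_, ?_⟩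
  · intro μ hμ ν hν hlt
    have hbm := key1 μ hμ
    obtain ⟨⟨h0, h1⟩, h2, -⟩ := hbμ μ hμ
    apply key2 ν _ hν hbm h1
    nlinarith [mul_pos (sub_pos.2 hlt) (hpos _ hbm h1)]
  · rw [tendsto_order]
    constructor
    · intro l hl
      filter_upwards [eventually_gt_atTop M] with μ hμ
      exact hl.trans (key1 μ hμ)
    · intro u hu
      have hx : b < min u 1 := lt_min hu hb2
      have hp := hpos _ hx (min_le_right _ _)
      filter_upwards [eventually_gt_atTop M,
        eventually_gt_atTop (g * (min u 1) ^ 2 / (2 * Fprim F (min u 1)))] with μ hμ hμ2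
      refine (key2 μ _ hμ hx (min_le_right _ _) ?_).trans_le (min_le_left _ _)
      rw [div_lt_iff₀ (by positivity)] at hμ2
      linarith
end

section
/- Let 0 < n₀ < m₀* and let T > 0. Then there exists p̌ ∈ (0,a) such that for every p₀ ∈ (0, p̌], one has σ_{n₀}(p₀, a) > T. -/
open Set intervalIntegral

/-- For `p₀` small enough, the time `σ_{n₀}(p₀, a)` exceeds any prescribed bound `T`. -/
theorem time_to_reach_a_large
    (g : ℝ) (hg : 0 < g)
    (F : ℝ → ℝ) (hFC1 : ContDiff ℝ 1 F)
    (a : ℝ) (ha0 : 0 < a) (ha1 : a < 1)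
    (hF0 : F 0 = 0) (hFa : F a = 0) (hF1 : F 1 = 0)
    (hFneg₁ : ∀ s, 0 < s → s < a → F s < 0)
    (hFneg₂ : ∀ s, 1 < s → F s < 0)
    (hFpos₁ : ∀ s, s < 0 → 0 < F s)
    (hFpos₂ : ∀ s, a < s → s < 1 → 0 < F s)
    (n₀ : ℝ) (hn₀0 : 0 < n₀) (hn₀ : n₀ < m0star g F a)
    (T : ℝ) (hT : 0 < T) :
    ∃ pc : ℝ, 0 < pc ∧ pc < a ∧
      ∀ p₀ : ℝ, 0 < p₀ → p₀ ≤ pc → T < sigmaMap g n₀ F p₀ a := by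
  -- linear bound on F
  obtain ⟨K, hK⟩ := (isCompact_Icc (a := (0:ℝ)) (b := a)).exists_bound_of_continuousOn
    (hFC1.continuous_deriv le_rfl).continuousOn
  have hK0 : 0 ≤ K := (norm_nonneg _).trans (hK 0 ⟨le_rfl, ha0.le⟩)
  have hlin : ∀ s ∈ Icc (0:ℝ) a, -F s ≤ K * s := by
    intro s hs
    have h := (convex_Icc (0:ℝ) a).norm_image_sub_le_of_norm_deriv_le (f := F) (C := K)
      (fun x _ => (hFC1.differentiable one_ne_zero) x) hK ⟨le_rfl, ha0.le⟩ hs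
    rw [hF0, sub_zero, sub_zero, Real.norm_eq_abs, Real.norm_eq_abs, abs_of_nonneg hs.1] at h
    exact (neg_le_abs _).trans h
  have hFc : Continuous F := hFC1.continuous
  have hFnp : ∀ s ∈ Icc (0:ℝ) a, F s ≤ 0 := by
    intro s hs
    rcases hs.1.eq_or_lt with h | h
    · rw [← h, hF0]
    rcases hs.2.eq_or_lt with h' | h'
    · rw [h', hFa]
    exact (hFneg₁ s h h').le
  have hdiff : ∀ p s : ℝ, Fprim F s - Fprim F p = ∫ u in p..s, F u := by
    intro p s
    exact intervalIntegral.integral_interval_sub_left (hFc.intervalIntegrable _ _)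
      (hFc.intervalIntegrable _ _)
  have hFpc : Continuous (Fprim F) :=
    intervalIntegral.continuous_primitive (fun _ _ => hFc.intervalIntegrable _ _) 0
  set C : ℝ := g + n₀ * K with hC
  have hCpos : 0 < C := by positivity
  have hsC : 0 < Real.sqrt C := Real.sqrt_pos.2 hCpos
  refine ⟨a * Real.exp (-(Real.sqrt C * (T + 1))), by positivity, ?_, ?_⟩
  · have : Real.exp (-(Real.sqrt C * (T + 1))) < 1 := by
      rw [Real.exp_lt_one_iff]
      have : 0 < Real.sqrt C * (T + 1) := by positivity
      linarith
    nlinarith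
  intro p hp hpc
  have hpa : p < a := by
    refine lt_of_le_of_lt hpc ?_
    have : Real.exp (-(Real.sqrt C * (T + 1))) < 1 := by
      rw [Real.exp_lt_one_iff]
      have : 0 < Real.sqrt C * (T + 1) := by positivity
      linarith
    nlinarith
  have hlow : ∀ s, p ≤ s → s ≤ a → Fprim F s - Fprim F p ≤ 0 := by
    intro s h1 h2
    rw [hdiff]
    have h := intervalIntegral.integral_mono_on h1 (hFc.intervalIntegrable p s)
      (continuous_const.intervalIntegrable p s : IntervalIntegrable (fun _ => (0:ℝ)) MeasureTheory.volume p s)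
      (fun u hu => hFnp u ⟨hp.le.trans hu.1, hu.2.trans h2⟩)
    simpa using h
  have hup : ∀ s, p ≤ s → s ≤ a → -(Fprim F s - Fprim F p) ≤ K * ((s ^ 2 - p ^ 2) / 2) := by
    intro s h1 h2
    rw [hdiff, ← intervalIntegral.integral_neg]
    have h := intervalIntegral.integral_mono_on (μ := MeasureTheory.volume) (f := fun u => -F u) (g := fun u => K * u) h1
      (hFc.neg.intervalIntegrable p s)
      ((continuous_const.mul continuous_id).intervalIntegrable p s)
      (fun u hu => hlin u ⟨hp.le.trans hu.1, hu.2.trans h2⟩)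
    rwa [intervalIntegral.integral_const_mul, integral_id] at h
  set Q : ℝ → ℝ := fun s => g * (s ^ 2 - p ^ 2) - 2 * n₀ * (Fprim F s - Fprim F p) with hQ
  have hQc : Continuous Q := by fun_prop
  have hQlow : ∀ s, p < s → s ≤ a → (g * p) * (s - p) ≤ Q s := by
    intro s h1 h2
    have h3 := mul_nonneg hn₀0.le (neg_nonneg.2 (hlow s h1.le h2))
    have h4 : 0 ≤ g * ((s - p) * s) :=
      mul_nonneg hg.le (mul_nonneg (by linarith) (by linarith))
    simp only [hQ]
    nlinarith
  have hQup : ∀ s, p < s → s ≤ a → Q s ≤ C * s ^ 2 := by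
    intro s h1 h2
    have h3 := mul_le_mul_of_nonneg_left (hup s h1.le h2) hn₀0.le
    have h4 : 0 ≤ C * p ^ 2 := by positivity
    simp only [hQ]
    rw [hC] at h4 ⊢
    nlinarith
  have hint : IntervalIntegrable (fun s => (Real.sqrt (Q s))⁻¹) MeasureTheory.volume p a := by
    have hb : IntervalIntegrable (fun s => (Real.sqrt (g * p))⁻¹ * (s - p) ^ (-(1/2) : ℝ))
        MeasureTheory.volume p a := by
      have h := (intervalIntegral.intervalIntegrable_rpow' (a := 0) (b := a - p)
        (r := -(1/2)) (by norm_num)).comp_sub_right p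
      simp only [zero_add, sub_add_cancel] at h
      exact h.const_mul _
    refine hb.mono_fun' ?_ ?_
    · exact (hQc.measurable.sqrt.inv).aestronglyMeasurable
    · refine (MeasureTheory.ae_restrict_iff' measurableSet_uIoc).2 (Filter.Eventually.of_forall ?_)
      intro s hs
      rw [uIoc_of_le hpa.le] at hs
      have hsp : 0 < s - p := sub_pos.2 hs.1
      have hgp : 0 < g * p := by positivity
      beta_reduce
      rw [Real.norm_of_nonneg (by positivity), Real.rpow_neg hsp.le, ← Real.sqrt_eq_rpow,
        ← mul_inv, ← Real.sqrt_mul hgp.le]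
      exact inv_anti₀ (Real.sqrt_pos.2 (by positivity)) (Real.sqrt_le_sqrt (hQlow s hs.1 hs.2))
  have hint2 : IntervalIntegrable (fun s : ℝ => (Real.sqrt C)⁻¹ * s⁻¹)
      MeasureTheory.volume p a := by
    refine IntervalIntegrable.const_mul ?_ _
    refine intervalIntegral.intervalIntegrable_inv ?_ continuousOn_id
    intro x hx
    rw [uIcc_of_le hpa.le] at hx
    exact (hp.trans_le hx.1).ne'
  have hmono := intervalIntegral.integral_mono_on_of_le_Ioo hpa.le hint2 hint (by
    intro s hs
    have hs0 : 0 < s := hp.trans hs.1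
    have hQ0 : 0 < Q s := lt_of_lt_of_le
      (mul_pos (mul_pos hg hp) (sub_pos.2 hs.1)) (hQlow s hs.1 hs.2.le)
    rw [← mul_inv]
    refine inv_anti₀ (Real.sqrt_pos.2 hQ0) ?_
    have h := Real.sqrt_le_sqrt (hQup s hs.1 hs.2.le)
    rwa [Real.sqrt_mul hCpos.le, Real.sqrt_sq hs0.le] at h)
  rw [intervalIntegral.integral_const_mul, integral_inv_of_pos hp ha0] at hmono
  have hlog : Real.sqrt C * (T + 1) ≤ Real.log (a / p) := by
    rw [Real.le_log_iff_exp_le (by positivity), le_div_iff₀ hp]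
    have h := mul_le_mul_of_nonneg_left hpc (Real.exp_pos (Real.sqrt C * (T + 1))).le
    have e : Real.exp (Real.sqrt C * (T + 1)) * (a * Real.exp (-(Real.sqrt C * (T + 1)))) = a := by
      rw [mul_left_comm, ← Real.exp_add]; simp
    rwa [e] at h
  have h5 : T + 1 ≤ (Real.sqrt C)⁻¹ * Real.log (a / p) := by
    rw [← div_eq_inv_mul, le_div_iff₀ hsC, mul_comm]
    exact hlog
  have h6 : sigmaMap g n₀ F p a = ∫ s in p..a, (Real.sqrt (Q s))⁻¹ := rfl
  rw [h6]
  linarith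
end

section
/- Assume F is strictly concave on [a,1] and 𝓕(1) = ∫₀¹ F(s) ds > 0, and set m₁* := g/(2𝓕(1)). Fix 0 < α < β and 0 < n₀ < m₀*, and set Λ := sup_{0<s≤1} F(s)/s and κ := cosh( ((β − α)/2) · √(g − n₀ Λ) ). Then there exist p̂₀ ∈ (0,a) and m₂* ≥ max(m₀*, m₁*) such that for every n₁ > m₂* and every p₀ ∈ (0, p̂₀): if p₁ denotes the unique point of (a,1) satisfying g p₁² − 2n₁ 𝓕(p₁) = g p₀² − 2n₁ 𝓕(p₀) (which lies in (a_{n₁}, b_{n₁})), then p₁ > b_{n₁}/κ and σ_{n₀}(p₁, b_{n₁}) < (β − α)/2. -/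
open Set intervalIntegral

theorem aux_diff (F : ℝ → ℝ) (hc : Continuous F) (x y : ℝ) :
    Fprim F y - Fprim F x = ∫ s in x..y, F s := by
  unfold Fprim
  exact intervalIntegral.integral_interval_sub_left (hc.intervalIntegrable _ _)
    (hc.intervalIntegrable _ _)

theorem aux_cont (F : ℝ → ℝ) (hc : Continuous F) : Continuous (Fprim F) := by
  unfold Fprim
  exact intervalIntegral.continuous_primitive (fun _ _ => hc.intervalIntegrable _ _) 0

theorem aux_pos (F : ℝ → ℝ) (hc : Continuous F) (a : ℝ)
    (hpos : ∀ s, a < s → s < 1 → 0 < F s) (x y : ℝ) (hx : a ≤ x) (hxy : x < y) (hy : y ≤ 1) :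
    Fprim F x < Fprim F y := by
  have h : 0 < ∫ s in x..y, F s :=
    intervalIntegral.intervalIntegral_pos_of_pos_on (hc.intervalIntegrable _ _)
      (fun s hs => hpos s (lt_of_le_of_lt hx hs.1) (lt_of_lt_of_le hs.2 hy)) hxy
  have := aux_diff F hc x y
  linarith

theorem aux_unif (F : ℝ → ℝ) (hc : Continuous F) (a : ℝ)
    (hpos : ∀ s, a < s → s < 1 → 0 < F s) (δ : ℝ) (hδ : 0 < δ) :
    ∃ η > 0, ∀ x y, a ≤ x → x + δ ≤ y → y ≤ 1 → η ≤ Fprim F y - Fprim F x := by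
  have hP := aux_cont F hc
  by_cases hne : a ≤ 1 - δ
  · have hcont : Continuous (fun x => Fprim F (x + δ) - Fprim F x) := by fun_prop
    obtain ⟨x0, hx0, hmin⟩ := isCompact_Icc.exists_isMinOn (nonempty_Icc.2 hne) hcont.continuousOn
    refine ⟨Fprim F (x0 + δ) - Fprim F x0, ?_, ?_⟩
    · have := aux_pos F hc a hpos x0 (x0 + δ) hx0.1 (by linarith) (by linarith [hx0.2])
      linarith
    · intro x y hx hxy hy
      have h1 := hmin (show x ∈ Icc a (1 - δ) from ⟨hx, by linarith⟩)
      simp only [Set.mem_ofPred_eq] at h1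
      rcases hxy.eq_or_lt with h | h
      · rw [← h]; exact h1
      · have := aux_pos F hc a hpos (x + δ) y (by linarith) h hy
        linarith
  · exact ⟨1, one_pos, fun x y hx hxy hy => absurd (by linarith) hne⟩

theorem aux_sigma (g : ℝ) (F : ℝ → ℝ) (hc : Continuous F) (a : ℝ) (ha0 : 0 < a)
    (M n₀ : ℝ) (hn₀ : 0 < n₀) (hM : ∀ s, 0 < s → s ≤ 1 → F s ≤ M * s) (hcM : n₀ * M < g)
    (p b : ℝ) (hp : a < p) (hpb : p < b) (hb : b ≤ 1) :
    sigmaMap g n₀ F p b ≤ (Real.sqrt (2 * a * (g - n₀ * M)))⁻¹ * (2 * Real.sqrt (b - p)) := by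
  set K := 2 * a * (g - n₀ * M) with hK
  have hKpos : 0 < K := by
    have : 0 < g - n₀ * M := by linarith
    positivity
  have hint : IntervalIntegrable (fun s => (Real.sqrt K)⁻¹ * (s - p) ^ (-(1/2) : ℝ))
      MeasureTheory.volume p b := by
    apply IntervalIntegrable.const_mul
    have h := (intervalIntegral.intervalIntegrable_rpow' (a := p - p) (b := b - p)
      (r := (-(1/2) : ℝ)) (by norm_num)).comp_sub_right p
    simpa using h
  have hval : ∫ s in p..b, (Real.sqrt K)⁻¹ * (s - p) ^ (-(1/2) : ℝ)
      = (Real.sqrt K)⁻¹ * (2 * Real.sqrt (b - p)) := by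
    rw [intervalIntegral.integral_const_mul,
      intervalIntegral.integral_comp_sub_right (fun s => s ^ (-(1/2) : ℝ)) p,
      integral_rpow (Or.inl (by norm_num)), Real.sqrt_eq_rpow (b - p)]
    norm_num
    left; ring
  rw [← hval]
  unfold sigmaMap
  rw [intervalIntegral.integral_of_le hpb.le, intervalIntegral.integral_of_le hpb.le]
  apply MeasureTheory.integral_mono_of_nonneg
  · exact Filter.Eventually.of_forall (fun s => by
      show (0:ℝ) ≤ _
      positivity)
  · exact (intervalIntegrable_iff_integrableOn_Ioc_of_le hpb.le).1 hint
  · refine (MeasureTheory.ae_restrict_iff' measurableSet_Ioc).2 (Filter.Eventually.of_forall ?_)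
    intro s hs
    have hsp : 0 < s - p := by linarith [hs.1]
    show _ ≤ (Real.sqrt K)⁻¹ * (s - p) ^ (-(1/2) : ℝ)
    rw [Real.rpow_neg hsp.le, ← Real.sqrt_eq_rpow, ← mul_inv, ← Real.sqrt_mul hKpos.le]
    apply inv_anti₀ (Real.sqrt_pos.2 (by positivity))
    apply Real.sqrt_le_sqrt
    have h1 : Fprim F s - Fprim F p ≤ M * ((s ^ 2 - p ^ 2) / 2) := by
      rw [aux_diff F hc, ← integral_id, ← intervalIntegral.integral_const_mul]
      apply intervalIntegral.integral_mono_on hs.1.le (hc.intervalIntegrable _ _)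
        ((continuous_const.mul continuous_id).intervalIntegrable _ _)
      intro t ht
      exact hM t (by linarith [ht.1]) (by linarith [ht.2, hs.2])
    have h2 : 2 * n₀ * (Fprim F s - Fprim F p) ≤ n₀ * M * (s ^ 2 - p ^ 2) := by
      have := mul_le_mul_of_nonneg_left h1 (show 0 ≤ 2 * n₀ by positivity)
      linarith
    have h3 : 2 * a * (s - p) ≤ s ^ 2 - p ^ 2 := by nlinarith
    have h4 := mul_le_mul_of_nonneg_left h3 (show 0 ≤ g - n₀ * M by linarith)
    rw [hK]
    linarith

/-- Key claim of Section 3: for `p₀` small and `n₁ > m₂*` large, the point `p₁` on the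
level line of `(E₁)` through `(p₀,0)` satisfies `p₁ > b_{n₁}/κ` and
`σ_{n₀}(p₁, b_{n₁}) < (β-α)/2`. -/
theorem fast_return_time_claim
    (g : ℝ) (hg : 0 < g)
    (F : ℝ → ℝ) (hFC1 : ContDiff ℝ 1 F)
    (a : ℝ) (ha0 : 0 < a) (ha1 : a < 1)
    (hF0 : F 0 = 0) (hFa : F a = 0) (hF1 : F 1 = 0)
    (hFneg₁ : ∀ s, 0 < s → s < a → F s < 0)
    (hFneg₂ : ∀ s, 1 < s → F s < 0)
    (hFpos₁ : ∀ s, s < 0 → 0 < F s)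
    (hFpos₂ : ∀ s, a < s → s < 1 → 0 < F s)
    (hconc : StrictConcaveOn ℝ (Set.Icc a 1) F)
    (hint : 0 < Fprim F 1)
    (α β : ℝ) (hα : 0 < α) (hαβ : α < β)
    (n₀ : ℝ) (hn₀0 : 0 < n₀) (hn₀ : n₀ < m0star g F a) :
    ∃ p₀hat : ℝ, p₀hat ∈ Set.Ioo 0 a ∧
      ∃ m2star : ℝ, max (m0star g F a) (g / (2 * Fprim F 1)) ≤ m2star ∧
        ∀ n₁ : ℝ, m2star < n₁ →
          ∀ p₀ ∈ Set.Ioo 0 p₀hat,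
            ∀ bn1 ∈ Set.Ioc (0:ℝ) 1,
              g * bn1 ^ 2 - 2 * n₁ * Fprim F bn1 = 0 →
              (∀ x ∈ Set.Ioc (0:ℝ) 1, g * x ^ 2 - 2 * n₁ * Fprim F x = 0 → x = bn1) →
              ∀ p₁ ∈ Set.Ioo a 1,
                g * p₁ ^ 2 - 2 * n₁ * Fprim F p₁ = g * p₀ ^ 2 - 2 * n₁ * Fprim F p₀ →
                bn1 / Real.cosh ((β - α) / 2 *
                    Real.sqrt (g - n₀ * sSup ((fun s => F s / s) '' Set.Ioc (0:ℝ) 1)))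
                  < p₁ ∧
                sigmaMap g n₀ F p₁ bn1 < (β - α) / 2 := by
  have hc : Continuous F := hFC1.continuous
  have hP := aux_cont F hc
  set M := sSup ((fun s => F s / s) '' Set.Icc a 1) with hMdef
  have hbdd : BddAbove ((fun s => F s / s) '' Set.Icc a 1) := by
    apply (isCompact_Icc.image_of_continuousOn _).bddAbove
    exact hc.continuousOn.div continuousOn_id (fun s hs => by
      have := hs.1
      exact (lt_of_lt_of_le ha0 this).ne.symm)
  have hM1 : ∀ s, a ≤ s → s ≤ 1 → F s / s ≤ M := fun s h1 h2 =>
    le_csSup hbdd ⟨s, ⟨h1, h2⟩, rfl⟩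
  have hMpos : 0 < M := by
    have h1 := hM1 ((a + 1) / 2) (by linarith) (by linarith)
    have h2 := hFpos₂ ((a + 1) / 2) (by linarith) (by linarith)
    have : 0 < F ((a + 1) / 2) / ((a + 1) / 2) := by positivity
    linarith
  have hM2 : ∀ s, 0 < s → s ≤ 1 → F s / s ≤ M := by
    intro s h0 h1
    rcases lt_or_ge s a with h | h
    · have := div_neg_of_neg_of_pos (hFneg₁ s h0 h) h0
      linarith
    · exact hM1 s h h1
  have hM3 : ∀ s, 0 < s → s ≤ 1 → F s ≤ M * s := fun s h0 h1 =>
    (div_le_iff₀ h0).1 (hM2 s h0 h1)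
  have hn : n₀ * M < g := by
    unfold m0star at hn₀
    exact (lt_div_iff₀ hMpos).1 hn₀
  set Λ := sSup ((fun s => F s / s) '' Set.Ioc (0:ℝ) 1) with hΛ
  have hΛM : Λ ≤ M := by
    apply csSup_le ((nonempty_Ioc.2 one_pos).image _)
    rintro _ ⟨s, hs, rfl⟩
    exact hM2 s hs.1 hs.2
  have hcΛ : 0 < g - n₀ * Λ := by
    have := mul_le_mul_of_nonneg_left hΛM hn₀0.le
    linarith
  set κ := Real.cosh ((β - α) / 2 * Real.sqrt (g - n₀ * Λ)) with hκ
  have hT : 0 < (β - α) / 2 := by linarith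
  have hκ1 : 1 < κ := by
    apply Real.one_lt_cosh.2
    have := Real.sqrt_pos.2 hcΛ
    positivity
  set K := Real.sqrt (2 * a * (g - n₀ * M)) with hK
  have hKpos : 0 < K := by
    apply Real.sqrt_pos.2
    have : 0 < g - n₀ * M := by linarith
    positivity
  set δ := min ((κ - 1) * a) ((K * ((β - α) / 2) / 2) ^ 2) with hδ
  have hδpos : 0 < δ := by
    apply lt_min
    · exact mul_pos (by linarith) ha0
    · positivity
  obtain ⟨η, hη, hunif⟩ := aux_unif F hc a hFpos₂ δ hδpos
  have hP0 : Fprim F 0 = 0 := by simp [Fprim]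
  obtain ⟨ε, hε, hεP⟩ := Metric.continuousAt_iff.1 (hP.continuousAt (x := 0)) (η / 2) (by positivity)
  refine ⟨min ε (a / 2), ⟨by positivity, lt_of_le_of_lt (min_le_right _ _) (by linarith)⟩,
    max (max (m0star g F a) (g / (2 * Fprim F 1))) (2 * g / η), le_max_left _ _, ?_⟩
  intro n₁ hn₁ p₀ hp₀ b hb hb0 _ p₁ hp₁ hlev
  have hn₁' : 2 * g / η < n₁ := lt_of_le_of_lt (le_max_right _ _) hn₁
  have hn₁pos : 0 < n₁ := lt_trans (by positivity) hn₁'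
  rcases le_or_gt b p₁ with hbp | hpb
  · constructor
    · exact lt_of_lt_of_le (div_lt_self hb.1 hκ1) hbp
    · refine lt_of_le_of_lt ?_ hT
      unfold sigmaMap
      rw [intervalIntegral.integral_symm]
      have : 0 ≤ ∫ s in b..p₁, (Real.sqrt (g * (s ^ 2 - p₁ ^ 2)
          - 2 * n₀ * (Fprim F s - Fprim F p₁)))⁻¹ :=
        intervalIntegral.integral_nonneg hbp (fun s _ => by positivity)
      linarith
  · have hclose : b - p₁ < δ := by
      by_contra hcon
      have h1 := hunif p₁ b hp₁.1.le (by linarith) hb.2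
      have hp0e : p₀ < ε := lt_of_lt_of_le hp₀.2 (min_le_left _ _)
      have hp0a : p₀ < a / 2 := lt_of_lt_of_le hp₀.2 (min_le_right _ _)
      have h2 := hεP (x := p₀) (by rw [Real.dist_eq, sub_zero, abs_of_pos hp₀.1]; exact hp0e)
      rw [Real.dist_eq, hP0, sub_zero] at h2
      have h3 := (abs_lt.1 h2).1
      have h4 : 2 * g < n₁ * η := (div_lt_iff₀ hη).1 hn₁'
      have h5 : 2 * n₁ * (Fprim F b - Fprim F p₁)
          = g * (b ^ 2 - p₁ ^ 2 + p₀ ^ 2) - 2 * n₁ * Fprim F p₀ := by linarith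
      have h6 : b ^ 2 - p₁ ^ 2 + p₀ ^ 2 ≤ 1 := by
        have := hp₁.1
        have := hp₀.1
        nlinarith [hb.1, hb.2]
      have h7 := mul_le_mul_of_nonneg_left h6 hg.le
      have h8 := mul_le_mul_of_nonneg_left h1 hn₁pos.le
      have h9 := mul_lt_mul_of_pos_left h3 hn₁pos
      linarith
    constructor
    · rw [div_lt_iff₀ (by linarith)]
      have h1 : b - p₁ < (κ - 1) * a := lt_of_lt_of_le hclose (min_le_left _ _)
      have h2 := mul_lt_mul_of_pos_left hp₁.1 (show 0 < κ - 1 by linarith)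
      linarith
    · refine lt_of_le_of_lt (aux_sigma g F hc a ha0 M n₀ hn₀0 hM3 hn p₁ b hp₁.1 hpb hb.2) ?_
      have h1 : b - p₁ < (K * ((β - α) / 2) / 2) ^ 2 := lt_of_lt_of_le hclose (min_le_right _ _)
      have h2 : Real.sqrt (b - p₁) < K * ((β - α) / 2) / 2 :=
        (Real.sqrt_lt' (by positivity)).2 h1
      rw [inv_mul_lt_iff₀ hKpos]
      linarith
end
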